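/- Let α < 1 and b ∈ FL^α. Then there exist a constant C (independent of n and b) and a sequence (b_n)_{n≥1} ⊆ FL^α such that: N_α(b_n) ≤ N_α(b) for every n; N_α(b − b_n) → 0 as n → ∞; and each b_n is a bounded continuous function which is Lipschitz continuous in the space variable with |b_n(t,x) − b_n(t,y)| ≤ C N_α(b) n^{1−α} |x−y| for all t ∈ ℝ and x, y ∈ ℝ^d. -/

import Mathlib

open MeasureTheory Filter Topology
open scoped ENNReal NNReal

noncomputable section

abbrev Euc (d : ℕ) : Type := EuclideanSpace ℝ (Fin d)

/-- `Y^w_{s,t}(ω,ξ) = ∫_s^t exp(i ξ·w_u + i ω u) du`. -/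
def Yint {d : ℕ} (w : ℝ → Euc d) (s t ω : ℝ) (ξ : Euc d) : ℂ :=
  ∫ u in s..t, Complex.exp (Complex.I * Complex.ofReal (inner ℝ ξ (w u) + ω * u))

/-- The averaging constant `K^w_{α,γ}`. -/
def avgK {d : ℕ} (w : ℝ → Euc d) (α γ : ℝ) : ℝ≥0∞ :=
  ⨆ (s : ℝ) (t : ℝ) (_ : 0 ≤ s) (_ : s < t) (_ : t ≤ 1) (ω : ℝ) (ξ : Euc d),
    ENNReal.ofReal (‖Yint w s t ω ξ‖ /
      ((1 + ‖ξ‖) ^ α * (1 + Real.sqrt (Real.log (1 + |ω|))) * (t - s) ^ γ))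

/-- The norm `N_α` of a space-time vector field given through its Fourier transform `bhat`. -/
def FLnorm (d : ℕ) (α : ℝ) (bhat : ℝ × Euc d → Fin d → ℂ) : ℝ≥0∞ :=
  ∫⁻ p : ℝ × Euc d, ENNReal.ofReal (‖bhat p‖ * (1 + ‖p.2‖) ^ α *
    (1 + Real.sqrt (Real.log (1 + |p.1|))))

/-- The vector field `b(t,x)` recovered from its space-time Fourier transform. -/
def fieldOf {d : ℕ} (bhat : ℝ × Euc d → Fin d → ℂ) (t : ℝ) (x : Euc d) : Euc d :=
  (EuclideanSpace.equiv (Fin d) ℝ).symm fun i =>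
    ∫ p : ℝ × Euc d, (bhat p i * Complex.exp (Complex.I * Complex.ofReal (p.1 * t + inner ℝ p.2 x))).re

/-- The averaged vector field `σ^w_{[s,t]} b`, defined through the Fourier representation. -/
def sigmaAvg {d : ℕ} (w : ℝ → Euc d) (bhat : ℝ × Euc d → Fin d → ℂ) (s t : ℝ) (x : Euc d) :
    Euc d :=
  (EuclideanSpace.equiv (Fin d) ℝ).symm fun i =>
    ∫ p : ℝ × Euc d, (bhat p i * Yint w s t p.1 p.2 *
      Complex.exp (Complex.I * Complex.ofReal (inner ℝ p.2 x))).re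

/-- Partitions of the interval `[s,t]`. -/
structure YoungPartition (s t : ℝ) where
  n : ℕ
  pts : ℕ → ℝ
  first : pts 0 = s
  last : pts n = t
  mono : ∀ i, i < n → pts i ≤ pts (i + 1)

/-- The mesh of the partition is smaller than `δ`. -/
def YoungPartition.MeshLt {s t : ℝ} (P : YoungPartition s t) (δ : ℝ) : Prop :=
  ∀ i, i < P.n → P.pts (i + 1) - P.pts i < δ

/-- Riemann sums `Σ_i (G_{t_{i+1}} - G_{t_i})(f_{t_i})` of the nonlinear Young integral. -/
def RiemannSum {V W : Type*} [AddCommGroup W] (G : ℝ → V → W) (f : ℝ → V)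
    {s t : ℝ} (P : YoungPartition s t) : W :=
  ∑ i ∈ Finset.range P.n, (G (P.pts (i + 1)) (f (P.pts i)) - G (P.pts i) (f (P.pts i)))

/-- `L` is the nonlinear Young integral `∫_s^t G_{du}(f_u)`: the Riemann sums converge to `L`
as the mesh of the partition tends to `0`. -/
def HasYoungIntegral {V W : Type*} [NormedAddCommGroup W] (G : ℝ → V → W) (f : ℝ → V)
    (s t : ℝ) (L : W) : Prop :=
  ∀ ε > 0, ∃ δ > 0, ∀ P : YoungPartition s t, P.MeshLt δ → ‖RiemannSum G f P - L‖ < ε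

/-- Riemann sums `Σ_i (σ^w_{[t_i,t_{i+1}]} b)(θ_{t_i})`. -/
def sigmaRiemannSum {d : ℕ} (w : ℝ → Euc d) (bhat : ℝ × Euc d → Fin d → ℂ)
    (θ : ℝ → Euc d) {s t : ℝ} (P : YoungPartition s t) : Euc d :=
  ∑ i ∈ Finset.range P.n, sigmaAvg w bhat (P.pts i) (P.pts (i + 1)) (θ (P.pts i))

/-- `L = ∫_s^t (σ^w_{du} b)(θ_u)` as a limit of Riemann sums. -/
def HasSigmaIntegral {d : ℕ} (w : ℝ → Euc d) (bhat : ℝ × Euc d → Fin d → ℂ)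
    (θ : ℝ → Euc d) (s t : ℝ) (L : Euc d) : Prop :=
  ∀ ε > 0, ∃ δ > 0, ∀ P : YoungPartition s t, P.MeshLt δ → ‖sigmaRiemannSum w bhat θ P - L‖ < ε

/-- `θ` solves the Young equation `θ_t = x₀ + ∫_0^t (σ^w_{du} b)(θ_u)` on `[0,1]`. -/
def SolvesSigmaYoung {d : ℕ} (w : ℝ → Euc d) (bhat : ℝ × Euc d → Fin d → ℂ)
    (x₀ : Euc d) (θ : ℝ → Euc d) : Prop :=
  θ 0 = x₀ ∧ ∀ t ∈ Set.Icc (0 : ℝ) 1, HasSigmaIntegral w bhat θ 0 t (θ t - x₀)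

/-- `γ`-Hölder continuity on `[0,1]`. -/
def HolderOnIcc {E : Type*} [NormedAddCommGroup E] (γ : ℝ) (f : ℝ → E) : Prop :=
  ∃ C : ℝ, ∀ s ∈ Set.Icc (0 : ℝ) 1, ∀ t ∈ Set.Icc (0 : ℝ) 1, ‖f t - f s‖ ≤ C * |t - s| ^ γ

/-- Covariance of the fractional Brownian motion of Hurst index `H`. -/
def fbmCov (H : ℝ) (s t : ℝ) : ℝ := (s ^ (2 * H) + t ^ (2 * H) - |t - s| ^ (2 * H)) / 2

/-- `W` is a `d`-dimensional fractional Brownian motion of Hurst parameter `H` with continuous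
sample paths: the coordinates are independent centered Gaussian processes with the fBm
covariance, expressed by asking every finite linear combination to be Gaussian. -/
def IsFBM {Ω : Type*} [MeasureSpace Ω] (d : ℕ) (H : ℝ) (W : Ω → ℝ → Euc d) : Prop :=
  (∀ ω, ContinuousOn (W ω) (Set.Icc 0 1)) ∧
  (∀ t, Measurable fun ω => W ω t) ∧
  (∀ ω, W ω 0 = 0) ∧
  ∀ (n : ℕ) (c : Fin n → ℝ) (t : Fin n → ℝ) (j : Fin n → Fin d),
    (∀ k, t k ∈ Set.Icc (0 : ℝ) 1) →
    Measure.map (fun ω => ∑ k, c k * W ω (t k) (j k)) (volume : Measure Ω) =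
      ProbabilityTheory.gaussianReal 0
        (Real.toNNReal (∑ k, ∑ l, c k * c l *
          (if j k = j l then fbmCov H (t k) (t l) else 0)))

/-- `R^w_λ = (∫_0^1 exp(λ |w_u|²) du)^{1/λ}`. -/
def Rconst {d : ℕ} (lam : ℝ) (w : ℝ → Euc d) : ℝ≥0∞ :=
  (∫⁻ u in Set.Icc (0 : ℝ) 1, ENNReal.ofReal (Real.exp (lam * ‖w u‖ ^ 2))) ^ (1 / lam)

/-- `S^w_λ`. -/
def Sconst {d : ℕ} (H lam : ℝ) (w : ℝ → Euc d) : ℝ≥0∞ :=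
  (∑' n : ℕ, ∑' m : ℕ, ∑ k ∈ Finset.range (2 ^ n), ∑' q : ℤ × (Fin d → ℤ),
    ENNReal.ofReal (
      (2 : ℝ) ^ (-(2 * (n : ℝ)) - (m : ℝ) * ((d : ℝ) + 2)) *
      (1 + |(q.1 : ℝ) / 2 ^ m|) ^ (-(2 : ℝ)) *
      (1 + ‖(EuclideanSpace.equiv (Fin d) ℝ).symm (fun i => (q.2 i : ℝ) / 2 ^ m)‖) ^
        (-((d : ℝ) + 1)) *
      Real.exp (lam * 2 ^ n *
        (1 + ‖(EuclideanSpace.equiv (Fin d) ℝ).symm (fun i => (q.2 i : ℝ) / 2 ^ m)‖) ^ (1 / H) *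
        ‖Yint w ((k : ℝ) / 2 ^ n) (((k : ℝ) + 1) / 2 ^ n) ((q.1 : ℝ) / 2 ^ m)
          ((EuclideanSpace.equiv (Fin d) ℝ).symm (fun i => (q.2 i : ℝ) / 2 ^ m))‖ ^ 2))) ^
  (1 / lam)

/-- `Q^w_λ = √(log S^w_λ) + √(log R^w_λ)`. -/
def Qconst {d : ℕ} (H lam : ℝ) (w : ℝ → Euc d) : ℝ :=
  Real.sqrt (Real.log (Sconst H lam w).toReal) + Real.sqrt (Real.log (Rconst lam w).toReal)

theorem Euc.norm_le_of_forall_abs_le {d : ℕ} {v : Euc d} {c : ℝ} (hc : 0 ≤ c)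
    (h : ∀ i, |v i| ≤ c) : ‖v‖ ≤ (d + 1) * c := by
  refine abs_le_of_sq_le_sq' ?_ (by positivity) |>.2
  rw [EuclideanSpace.norm_sq_eq]
  calc ∑ i, ‖v i‖ ^ 2 ≤ ∑ _i : Fin d, c ^ 2 :=
        Finset.sum_le_sum fun i _ => pow_le_pow_left₀ (norm_nonneg _) (h i) 2
    _ = d * c ^ 2 := by simp
    _ ≤ ((d + 1) * c) ^ 2 := by
        have : (0 : ℝ) ≤ d := d.cast_nonneg
        nlinarith [sq_nonneg c, mul_nonneg (sq_nonneg (d : ℝ)) (sq_nonneg c),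
          mul_nonneg this (sq_nonneg c)]

theorem norm_exp_I_mul_ofReal_sub_le (a b : ℝ) :
    ‖Complex.exp (Complex.I * (a : ℂ)) - Complex.exp (Complex.I * (b : ℂ))‖ ≤ |a - b| := by
  have h : Complex.exp (Complex.I * (a : ℂ)) - Complex.exp (Complex.I * (b : ℂ)) =
      Complex.exp (Complex.I * (b : ℂ)) * (Complex.exp (Complex.I * ((a - b : ℝ) : ℂ)) - 1) := by
    rw [mul_sub, ← Complex.exp_add]
    push_cast
    ring_nf
  rw [h, norm_mul, Complex.norm_exp_I_mul_ofReal, one_mul]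
  exact Real.norm_exp_I_mul_ofReal_sub_one_le

section Field

variable {d : ℕ} {c : ℝ × Euc d → Fin d → ℂ}

theorem fieldOf_apply (c : ℝ × Euc d → Fin d → ℂ) (t : ℝ) (x : Euc d) (i : Fin d) :
    fieldOf c t x i = ∫ p : ℝ × Euc d,
      (c p i * Complex.exp (Complex.I * Complex.ofReal (p.1 * t + inner ℝ p.2 x))).re := rfl

theorem aestronglyMeasurable_fieldOf_integrand (hc : AEStronglyMeasurable c volume) (t : ℝ)
    (x : Euc d) (i : Fin d) :
    AEStronglyMeasurable (fun p : ℝ × Euc d =>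
      (c p i * Complex.exp (Complex.I * Complex.ofReal (p.1 * t + inner ℝ p.2 x))).re) volume := by
  have hi : AEStronglyMeasurable (fun p => c p i) volume :=
    (continuous_apply i).comp_aestronglyMeasurable hc
  have he : Continuous fun p : ℝ × Euc d =>
      Complex.exp (Complex.I * Complex.ofReal (p.1 * t + inner ℝ p.2 x)) := by fun_prop
  exact Complex.continuous_re.comp_aestronglyMeasurable (hi.mul he.aestronglyMeasurable)

theorem norm_fieldOf_integrand_le (c : ℝ × Euc d → Fin d → ℂ) (t : ℝ) (x : Euc d) (i : Fin d)
    (p : ℝ × Euc d) :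
    ‖(c p i * Complex.exp (Complex.I * Complex.ofReal (p.1 * t + inner ℝ p.2 x))).re‖ ≤ ‖c p‖ := by
  refine (Complex.abs_re_le_norm _).trans ?_
  rw [norm_mul, Complex.norm_exp_I_mul_ofReal, mul_one]
  exact norm_le_pi_norm (c p) i

theorem integrable_fieldOf_integrand (hc : Integrable c) (t : ℝ) (x : Euc d) (i : Fin d) :
    Integrable fun p : ℝ × Euc d =>
      (c p i * Complex.exp (Complex.I * Complex.ofReal (p.1 * t + inner ℝ p.2 x))).re :=
  hc.norm.mono' (aestronglyMeasurable_fieldOf_integrand hc.1 t x i)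
    (Eventually.of_forall fun p => norm_fieldOf_integrand_le c t x i p)

theorem continuous_fieldOf (hc : Integrable c) :
    Continuous fun q : ℝ × Euc d => fieldOf c q.1 q.2 := by
  refine (EuclideanSpace.equiv (Fin d) ℝ).symm.continuous.comp (continuous_pi fun i => ?_)
  exact continuous_of_dominated
    (fun q => aestronglyMeasurable_fieldOf_integrand hc.1 q.1 q.2 i)
    (fun q => Eventually.of_forall fun p => norm_fieldOf_integrand_le c q.1 q.2 i p) hc.norm
    (Eventually.of_forall fun p => by fun_prop)

theorem norm_fieldOf_le (hc : Integrable c) (t : ℝ) (x : Euc d) :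
    ‖fieldOf c t x‖ ≤ (d + 1) * ∫ p, ‖c p‖ :=
  Euc.norm_le_of_forall_abs_le (integral_nonneg fun _ => norm_nonneg _) fun i =>
    norm_integral_le_of_norm_le hc.norm
      (Eventually.of_forall fun p => norm_fieldOf_integrand_le c t x i p)

theorem norm_fieldOf_sub_le (hc : Integrable c)
    (hc' : Integrable fun p : ℝ × Euc d => ‖c p‖ * ‖p.2‖) (t : ℝ) (x y : Euc d) :
    ‖fieldOf c t x - fieldOf c t y‖ ≤
      (d + 1) * ((∫ p : ℝ × Euc d, ‖c p‖ * ‖p.2‖) * ‖x - y‖) := by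
  refine Euc.norm_le_of_forall_abs_le
    (mul_nonneg (integral_nonneg fun _ => by positivity) (norm_nonneg _)) fun i => ?_
  rw [PiLp.sub_apply, fieldOf_apply, fieldOf_apply,
    ← integral_sub (integrable_fieldOf_integrand hc t x i) (integrable_fieldOf_integrand hc t y i),
    ← integral_mul_const, ← Real.norm_eq_abs]
  refine norm_integral_le_of_norm_le (hc'.mul_const _) (Eventually.of_forall fun p => ?_)
  rw [← Complex.sub_re, ← mul_sub]
  refine (Complex.abs_re_le_norm _).trans ?_
  rw [norm_mul, mul_assoc]
  refine mul_le_mul (norm_le_pi_norm (c p) i) ?_ (norm_nonneg _) (norm_nonneg _)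
  refine (norm_exp_I_mul_ofReal_sub_le _ _).trans ?_
  rw [add_sub_add_left_eq_sub, ← inner_sub_right]
  exact abs_real_inner_le_norm _ _

end Field

section Cutoff

variable {α r s : ℝ}

/-- The Fourier multiplier `(r/(r+s))^{1-α}`, evaluated at the frequency modulus `s`. -/
def cutoff (α r s : ℝ) : ℝ := (r / (r + s)) ^ (1 - α)

theorem cutoff_nonneg (hr : 0 ≤ r) (hs : 0 ≤ s) : 0 ≤ cutoff α r s :=
  Real.rpow_nonneg (by positivity) _

theorem cutoff_le_one (hα : α ≤ 1) (hr : 0 ≤ r) (hs : 0 ≤ s) : cutoff α r s ≤ 1 :=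
  Real.rpow_le_one (by positivity) (div_le_one_of_le₀ (by linarith) (by linarith)) (by linarith)

theorem cutoff_mul_le (hα : α ≤ 1) (hr : 1 ≤ r) (hs : 0 ≤ s) :
    cutoff α r s * (1 + s) ≤ r ^ (1 - α) * (1 + s) ^ α := by
  have hs' : 0 < 1 + s := by linarith
  calc cutoff α r s * (1 + s) ≤ (r / (1 + s)) ^ (1 - α) * (1 + s) := by
        refine mul_le_mul_of_nonneg_right ?_ hs'.le
        refine Real.rpow_le_rpow (by positivity) ?_ (by linarith)
        gcongr
    _ = r ^ (1 - α) * ((1 + s) ^ (1 : ℝ) / (1 + s) ^ (1 - α)) := by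
        rw [Real.div_rpow (by linarith) hs'.le, Real.rpow_one]
        ring
    _ = r ^ (1 - α) * (1 + s) ^ α := by
        rw [← Real.rpow_sub hs', sub_sub_cancel]

theorem tendsto_cutoff (α s : ℝ) : Tendsto (fun n : ℕ => cutoff α n s) atTop (𝓝 1) := by
  have h : Tendsto (fun n : ℕ => (n : ℝ) / (n + s)) atTop (𝓝 1) :=
    tendsto_natCast_div_add_atTop s
  simpa [cutoff] using h.rpow_const (p := 1 - α) (Or.inl one_ne_zero)

theorem measurable_cutoff (α r : ℝ) : Measurable (cutoff α r) := by
  unfold cutoff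
  fun_prop

end Cutoff

/-- The integrand of `FLnorm`. -/
def FLdensity {d : ℕ} (α : ℝ) (c : ℝ × Euc d → Fin d → ℂ) (p : ℝ × Euc d) : ℝ :=
  ‖c p‖ * (1 + ‖p.2‖) ^ α * (1 + Real.sqrt (Real.log (1 + |p.1|)))

section Density

variable {d : ℕ} {α : ℝ} {c : ℝ × Euc d → Fin d → ℂ}

theorem FLdensity_nonneg (α : ℝ) (c : ℝ × Euc d → Fin d → ℂ) (p : ℝ × Euc d) :
    0 ≤ FLdensity α c p := by
  unfold FLdensity
  positivity

theorem norm_mul_rpow_le_FLdensity (α : ℝ) (c : ℝ × Euc d → Fin d → ℂ) (p : ℝ × Euc d) :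
    ‖c p‖ * (1 + ‖p.2‖) ^ α ≤ FLdensity α c p :=
  le_mul_of_one_le_right (by positivity) (le_add_of_nonneg_right (Real.sqrt_nonneg _))

theorem FLdensity_smul (α : ℝ) (m : ℝ × Euc d → ℝ) (c : ℝ × Euc d → Fin d → ℂ) (p : ℝ × Euc d) :
    FLdensity α (fun p => m p • c p) p = |m p| * FLdensity α c p := by
  simp only [FLdensity, norm_smul, Real.norm_eq_abs]
  ring

theorem aestronglyMeasurable_FLdensity (α : ℝ) (hc : AEStronglyMeasurable c volume) :
    AEStronglyMeasurable (FLdensity α c) volume := by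
  have h₁ : Measurable fun p : ℝ × Euc d => (1 + ‖p.2‖) ^ α := by fun_prop
  have h₂ : Measurable fun p : ℝ × Euc d => 1 + Real.sqrt (Real.log (1 + |p.1|)) := by fun_prop
  exact (hc.norm.mul h₁.aestronglyMeasurable).mul h₂.aestronglyMeasurable

theorem integrable_FLdensity (hc : AEStronglyMeasurable c volume) (h : FLnorm d α c < ⊤) :
    Integrable (FLdensity α c) := by
  refine ⟨aestronglyMeasurable_FLdensity α hc, ?_⟩
  rw [hasFiniteIntegral_iff_ofReal (Eventually.of_forall (FLdensity_nonneg α c))]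
  exact h

theorem integral_FLdensity (hc : AEStronglyMeasurable c volume) :
    ∫ p, FLdensity α c p = (FLnorm d α c).toReal :=
  integral_eq_lintegral_of_nonneg_ae (Eventually.of_forall (FLdensity_nonneg α c))
    (aestronglyMeasurable_FLdensity α hc)

end Density

section Mollify

variable {d : ℕ} {α : ℝ} {c : ℝ × Euc d → Fin d → ℂ}

/-- The field with Fourier transform `(n/(n+|ξ|))^{1-α} b̂(ω,ξ)`. -/
def mollify (α : ℝ) (c : ℝ × Euc d → Fin d → ℂ) (n : ℕ) (p : ℝ × Euc d) : Fin d → ℂ :=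
  cutoff α n ‖p.2‖ • c p

theorem aestronglyMeasurable_mollify (α : ℝ) (hc : AEStronglyMeasurable c volume) (n : ℕ) :
    AEStronglyMeasurable (mollify α c n) volume :=
  ((measurable_cutoff α n).comp measurable_snd.norm).aestronglyMeasurable.smul hc

theorem FLnorm_mollify_le (hα : α ≤ 1) (c : ℝ × Euc d → Fin d → ℂ) (n : ℕ) :
    FLnorm d α (mollify α c n) ≤ FLnorm d α c := by
  refine lintegral_mono fun p => ENNReal.ofReal_le_ofReal ?_
  change FLdensity α (fun p => cutoff α n ‖p.2‖ • c p) p ≤ FLdensity α c p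
  rw [FLdensity_smul, abs_of_nonneg (cutoff_nonneg n.cast_nonneg (norm_nonneg _))]
  exact mul_le_of_le_one_left (FLdensity_nonneg α c p)
    (cutoff_le_one hα n.cast_nonneg (norm_nonneg _))

theorem tendsto_FLnorm_sub_mollify (hα : α ≤ 1) (hc : AEStronglyMeasurable c volume)
    (h : FLnorm d α c < ⊤) :
    Tendsto (fun n => FLnorm d α (fun p => c p - mollify α c n p)) atTop (𝓝 0) := by
  have key : ∀ n p, FLdensity α (fun p => c p - mollify α c n p) p =
      (1 - cutoff α n ‖p.2‖) * FLdensity α c p := by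
    intro n p
    have : (fun p => c p - mollify α c n p) = fun p => (1 - cutoff α n ‖p.2‖) • c p := by
      funext p
      rw [sub_smul, one_smul, mollify]
    rw [this, FLdensity_smul, abs_of_nonneg]
    exact sub_nonneg.2 (cutoff_le_one hα n.cast_nonneg (norm_nonneg _))
  have hlim := tendsto_lintegral_of_dominated_convergence' (μ := (volume : Measure (ℝ × Euc d)))
    (F := fun n p => ENNReal.ofReal (FLdensity α (fun p => c p - mollify α c n p) p))
    (f := fun _ => 0) (fun p => ENNReal.ofReal (FLdensity α c p))
    (fun n => (aestronglyMeasurable_FLdensity α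
      (hc.sub (aestronglyMeasurable_mollify α hc n))).aemeasurable.ennreal_ofReal)
    (fun n => Eventually.of_forall fun p => ENNReal.ofReal_le_ofReal <| by
      rw [key]
      exact mul_le_of_le_one_left (FLdensity_nonneg α c p)
        (sub_le_self _ (cutoff_nonneg n.cast_nonneg (norm_nonneg _))))
    h.ne
    (Eventually.of_forall fun p => by
      simp only [key]
      have := ((tendsto_cutoff α ‖p.2‖).const_sub 1).mul_const (FLdensity α c p)
      simpa using ENNReal.tendsto_ofReal this)
  rw [lintegral_zero] at hlim
  exact hlim

theorem norm_mollify_mul_le (hα : α ≤ 1) (c : ℝ × Euc d → Fin d → ℂ) {n : ℕ} (hn : 1 ≤ n)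
    (p : ℝ × Euc d) :
    ‖mollify α c n p‖ * (1 + ‖p.2‖) ≤ (n : ℝ) ^ (1 - α) * FLdensity α c p := by
  rw [mollify, norm_smul, Real.norm_eq_abs,
    abs_of_nonneg (cutoff_nonneg n.cast_nonneg (norm_nonneg _))]
  calc cutoff α n ‖p.2‖ * ‖c p‖ * (1 + ‖p.2‖)
      = ‖c p‖ * (cutoff α n ‖p.2‖ * (1 + ‖p.2‖)) := by ring
    _ ≤ ‖c p‖ * ((n : ℝ) ^ (1 - α) * (1 + ‖p.2‖) ^ α) := by
        refine mul_le_mul_of_nonneg_left ?_ (norm_nonneg _)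
        exact cutoff_mul_le hα (Nat.one_le_cast.2 hn) (norm_nonneg _)
    _ = (n : ℝ) ^ (1 - α) * (‖c p‖ * (1 + ‖p.2‖) ^ α) := by ring
    _ ≤ (n : ℝ) ^ (1 - α) * FLdensity α c p := by
        gcongr
        exact norm_mul_rpow_le_FLdensity α c p

theorem integrable_mollify (hα : α ≤ 1) (hc : AEStronglyMeasurable c volume)
    (h : FLnorm d α c < ⊤) {n : ℕ} (hn : 1 ≤ n) : Integrable (mollify α c n) :=
  ((integrable_FLdensity hc h).const_mul _).mono' (aestronglyMeasurable_mollify α hc n)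
    (Eventually.of_forall fun p => (le_mul_of_one_le_right (norm_nonneg _)
      (le_add_of_nonneg_right (norm_nonneg _))).trans (norm_mollify_mul_le hα c hn p))

theorem norm_mollify_mul_norm_le (hα : α ≤ 1) (c : ℝ × Euc d → Fin d → ℂ) {n : ℕ} (hn : 1 ≤ n)
    (p : ℝ × Euc d) :
    ‖mollify α c n p‖ * ‖p.2‖ ≤ (n : ℝ) ^ (1 - α) * FLdensity α c p :=
  (mul_le_mul_of_nonneg_left (by linarith) (norm_nonneg _)).trans (norm_mollify_mul_le hα c hn p)

theorem integrable_norm_mollify_mul_norm (hα : α ≤ 1) (hc : AEStronglyMeasurable c volume)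
    (h : FLnorm d α c < ⊤) {n : ℕ} (hn : 1 ≤ n) :
    Integrable fun p : ℝ × Euc d => ‖mollify α c n p‖ * ‖p.2‖ := by
  refine ((integrable_FLdensity hc h).const_mul ((n : ℝ) ^ (1 - α))).mono'
    ((aestronglyMeasurable_mollify α hc n).norm.mul continuous_snd.norm.aestronglyMeasurable)
    (Eventually.of_forall fun p => ?_)
  rw [Real.norm_of_nonneg (by positivity)]
  exact norm_mollify_mul_norm_le hα c hn p

theorem norm_fieldOf_mollify_sub_le (hα : α ≤ 1) (hc : AEStronglyMeasurable c volume)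
    (h : FLnorm d α c < ⊤) {n : ℕ} (hn : 1 ≤ n) (t : ℝ) (x y : Euc d) :
    ‖fieldOf (mollify α c n) t x - fieldOf (mollify α c n) t y‖ ≤
      (d + 1) * (FLnorm d α c).toReal * (n : ℝ) ^ (1 - α) * ‖x - y‖ := by
  have hint := integrable_norm_mollify_mul_norm hα hc h hn
  have hle : ∫ p : ℝ × Euc d, ‖mollify α c n p‖ * ‖p.2‖ ≤
      (n : ℝ) ^ (1 - α) * (FLnorm d α c).toReal := by
    rw [← integral_FLdensity hc, ← integral_const_mul]
    exact integral_mono hint ((integrable_FLdensity hc h).const_mul _)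
      (norm_mollify_mul_norm_le hα c hn)
  calc ‖fieldOf (mollify α c n) t x - fieldOf (mollify α c n) t y‖
      ≤ (d + 1) * ((∫ p : ℝ × Euc d, ‖mollify α c n p‖ * ‖p.2‖) * ‖x - y‖) :=
        norm_fieldOf_sub_le (integrable_mollify hα hc h hn) hint t x y
    _ ≤ (d + 1) * (((n : ℝ) ^ (1 - α) * (FLnorm d α c).toReal) * ‖x - y‖) := by gcongr
    _ = _ := by ring

end Mollify

/-! `FLnorm` does not presuppose that its argument is measurable. Fields which are not measurable
are cut off to a set such that neither it nor its complement contains a measurable set of positive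
measure. -/

theorem exists_rat_linearMap_map_one : ∃ f : ℝ →ₗ[ℚ] ℚ, f 1 = 1 := by
  obtain ⟨f, hf⟩ := (Algebra.linearMap ℚ ℝ).exists_leftInverse_of_injective
    (LinearMap.ker_eq_bot.2 (algebraMap ℚ ℝ).injective)
  exact ⟨f, by simpa using LinearMap.congr_fun hf 1⟩

theorem exists_norm_lt_map_eq_one {f : ℝ →ₗ[ℚ] ℚ} (hf : f 1 = 1) {ε : ℝ} (hε : 0 < ε) :
    ∃ r : ℝ, |r| < ε ∧ f r = 1 := by
  have hrat : ∀ q : ℚ, f (q : ℝ) = q := fun q => by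
    have := f.map_smul q 1
    rwa [hf, Rat.smul_def, mul_one, smul_eq_mul, mul_one] at this
  set k : ℝ := √2 - (f √2 : ℝ) with hk
  have hk0 : k ≠ 0 := fun h => irrational_sqrt_two ⟨f √2, (sub_eq_zero.1 h).symm⟩
  have hfk : f k = 0 := by rw [hk, map_sub, hrat, sub_self]
  obtain ⟨q, hq⟩ := Rat.denseRange_cast.exists_dist_lt (-1 / k) (div_pos hε (abs_pos.2 hk0))
  refine ⟨1 + q • k, ?_, by rw [map_add, map_smul, hf, hfk, smul_zero, add_zero]⟩
  have : 1 + q • k = -((-1 / k - q) * k) := by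
    rw [Rat.smul_def]
    field_simp
    ring
  rw [this, abs_neg, abs_mul]
  rwa [Real.dist_eq, lt_div_iff₀ (abs_pos.2 hk0)] at hq

/-- A set and its complement both contain only null measurable sets. -/
def IsInnerNullSplit {X : Type*} [MeasurableSpace X] (μ : Measure X) (S : Set X) : Prop :=
  ∀ K : Set X, MeasurableSet K → K ⊆ S ∨ K ⊆ Sᶜ → μ K = 0

theorem IsInnerNullSplit.compl {X : Type*} [MeasurableSpace X] {μ : Measure X} {S : Set X}
    (hS : IsInnerNullSplit μ S) : IsInnerNullSplit μ Sᶜ :=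
  fun K hK h => hS K hK (by rwa [compl_compl, or_comm] at h)

open scoped Pointwise in
theorem exists_isInnerNullSplit (d : ℕ) :
    ∃ S : Set (ℝ × Euc d), IsInnerNullSplit volume S := by
  obtain ⟨f, hf⟩ := exists_rat_linearMap_map_one
  refine ⟨{p | Even ⌊f p.1⌋}, fun K hK h => ?_⟩
  by_contra hpos
  have : (volume : Measure (ℝ × Euc d)).IsAddHaarMeasure :=
    inferInstanceAs ((volume : Measure ℝ).prod (volume : Measure (Euc d))).IsAddHaarMeasure
  have hnhds := Measure.sub_mem_nhds_zero_of_addHaar_pos volume K hK (pos_iff_ne_zero.2 hpos)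
  obtain ⟨ε, hε, hball⟩ := Metric.mem_nhds_iff.1 hnhds
  obtain ⟨r, hr, hfr⟩ := exists_norm_lt_map_eq_one hf hε
  obtain ⟨p, hp, q, hq, hpq⟩ : ((r, 0) : ℝ × Euc d) ∈ K - K :=
    hball (by simpa [Prod.norm_def] using hr)
  have hfloor : ⌊f p.1⌋ = ⌊f q.1⌋ + 1 := by
    have : p.1 = q.1 + r := sub_eq_iff_eq_add'.1 (congrArg Prod.fst hpq)
    rw [this, map_add, hfr, Int.floor_add_one]
  have hparity : Even ⌊f p.1⌋ ↔ ¬Even ⌊f q.1⌋ := by rw [hfloor, Int.even_add_one]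
  rcases h with h | h
  · exact hparity.1 (h hp) (h hq)
  · exact h hp (hparity.2 (h hq))

section InnerNull

variable {X : Type*} [MeasurableSpace X] {μ : Measure X} {S : Set X}

theorem IsInnerNullSplit.lintegral_eq_zero (hS : IsInnerNullSplit μ S) {g : X → ℝ≥0∞}
    (hg : ∀ x ∉ S, g x = 0) : ∫⁻ x, g x ∂μ = 0 := by
  obtain ⟨φ, hφ, hle, heq⟩ := exists_measurable_le_lintegral_eq μ g
  rw [heq, lintegral_eq_zero_iff hφ]
  refine hS {x | ¬φ x = 0} (hφ (measurableSet_singleton 0)).compl (Or.inl fun x hx => ?_)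
  by_contra hxS
  exact hx (le_antisymm ((hle x).trans_eq (hg x hxS)) zero_le)

theorem IsInnerNullSplit.integral_eq_zero (hS : IsInnerNullSplit μ S) {g : X → ℝ}
    (hg : ∀ x ∉ S, g x = 0) : ∫ x, g x ∂μ = 0 := by
  by_cases hm : AEStronglyMeasurable g μ
  · refine integral_eq_zero_of_ae ?_
    obtain ⟨K, hK, hKm, hKae⟩ := hm.nullMeasurableSet_support.exists_measurable_subset_ae_eq
    have hKS : K ⊆ S := fun x hx => by
      by_contra hxS
      exact hK hx (hg x hxS)
    exact (measure_congr hKae).symm.trans (hS K hKm (Or.inl hKS))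
  · exact integral_non_aestronglyMeasurable hm

end InnerNull

/-- Approximation in `FL^α`, `α < 1`: there are `bₙ ∈ FL^α` with
`N_α(bₙ) ≤ N_α(b)`, `N_α(b−bₙ) → 0`, each `bₙ` bounded continuous and Lipschitz in the
space variable with constant `C N_α(b) n^{1−α}` for a constant `C` independent of `n, b`. -/
theorem statement13 (d : ℕ) (α : ℝ) (hα : α < 1) :
    ∃ C : ℝ, 0 < C ∧ ∀ bhat : ℝ × Euc d → Fin d → ℂ, FLnorm d α bhat < ⊤ →
      ∃ bnhat : ℕ → ℝ × Euc d → Fin d → ℂ,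
        (∀ n, 1 ≤ n → FLnorm d α (bnhat n) ≤ FLnorm d α bhat) ∧
        Tendsto (fun n => FLnorm d α (fun p => bhat p - bnhat n p)) atTop (𝓝 0) ∧
        ∀ n : ℕ, 1 ≤ n →
          (Continuous fun q : ℝ × Euc d => fieldOf (bnhat n) q.1 q.2) ∧
          (∃ M : ℝ, ∀ (t : ℝ) (x : Euc d), ‖fieldOf (bnhat n) t x‖ ≤ M) ∧
          ∀ (t : ℝ) (x y : Euc d), ‖fieldOf (bnhat n) t x - fieldOf (bnhat n) t y‖ ≤
            C * (FLnorm d α bhat).toReal * (n : ℝ) ^ (1 - α) * ‖x - y‖ := by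
  refine ⟨d + 1, by positivity, fun bhat hb => ?_⟩
  by_cases hm : AEStronglyMeasurable bhat volume
  · refine ⟨mollify α bhat, fun n _ => FLnorm_mollify_le hα.le bhat n,
      tendsto_FLnorm_sub_mollify hα.le hm hb, fun n hn => ?_⟩
    have hint := integrable_mollify hα.le hm hb hn
    exact ⟨continuous_fieldOf hint, ⟨_, norm_fieldOf_le hint⟩,
      norm_fieldOf_mollify_sub_le hα.le hm hb hn⟩
  · obtain ⟨S, hS⟩ := exists_isInnerNullSplit d
    have hfield : ∀ t x, fieldOf (S.indicator bhat) t x = 0 := fun t x => by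
      ext i
      exact hS.integral_eq_zero fun p hp => by simp [hp]
    refine ⟨fun _ => S.indicator bhat, fun n _ => ?_, ?_, fun n _ => ⟨?_, ⟨0, ?_⟩, ?_⟩⟩
    · refine (hS.lintegral_eq_zero fun p hp => ?_).trans_le zero_le
      simp [hp]
    · refine tendsto_const_nhds.congr fun _ => (hS.compl.lintegral_eq_zero fun p hp => ?_).symm
      simp [Set.notMem_compl_iff.1 hp]
    · simp only [hfield]
      exact continuous_const
    · simp [hfield]
    · intro t x y
      simp only [hfield, sub_self, norm_zero]
      positivity
end
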